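/- Let s ≥ t be real numbers, 0 < p_0 < p_1 ≤ ∞ and 0 < q_0, q_1 ≤ ∞ be such that either s > t or q_0 < q_1. Then the natural embedding ℓ^{q_0}((2^{js}·ℓ^{p_0})_{j≥0}) ↪ ℓ^{q_1}((2^{jt}·ℓ^{p_1})_{j≥0}) is finitely strictly singular; in particular it is strictly singular. -/

import Mathlib

/-!
STATEMENT 6: Let s ≥ t, 0 < p₀ < p₁ ≤ ∞, 0 < q₀, q₁ ≤ ∞ with s > t or q₀ < q₁.
Then the natural embedding ℓ^{q₀}((2^{js}·ℓ^{p₀})_j) ↪ ℓ^{q₁}((2^{jt}·ℓ^{p₁})_j)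
is finitely strictly singular; in particular it is strictly singular.
-/

open scoped ENNReal

namespace Stmt6

/-- The `ℓ^q`-norm of a family of extended-nonnegative numbers. -/
noncomputable def eSeqNorm {ι : Type*} (q : ℝ≥0∞) (f : ι → ℝ≥0∞) : ℝ≥0∞ :=
  if q = ∞ then ⨆ i, f i else (∑' i, f i ^ q.toReal) ^ (1 / q.toReal)

/-- The scalar `ℓ^p`-(quasi-)norm of a real sequence. -/
noncomputable def elpNorm {ι : Type*} (p : ℝ≥0∞) (a : ι → ℝ) : ℝ≥0∞ :=
  eSeqNorm p fun i => ENNReal.ofReal |a i|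

/-- The norm of `ℓ^q((2^{js}·ℓ^p)_{j≥0})` on double sequences. -/
noncomputable def wNorm (q : ℝ≥0∞) (s : ℝ) (p : ℝ≥0∞) (x : ℕ → ℕ → ℝ) : ℝ≥0∞ :=
  eSeqNorm q fun j : ℕ => (2 : ℝ≥0∞) ^ ((j : ℝ) * s) * elpNorm p (x j)

/-- `T` is strictly singular w.r.t. the (extended-valued) norms `M₀`, `M₁`. -/
def StrictlySingular {V₀ V₁ : Type*} [AddCommGroup V₀] [Module ℝ V₀]
    [AddCommGroup V₁] [Module ℝ V₁]
    (M₀ : V₀ → ℝ≥0∞) (M₁ : V₁ → ℝ≥0∞) (T : V₀ →ₗ[ℝ] V₁) : Prop :=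
  ∀ Z : Submodule ℝ V₀, (∀ x ∈ Z, M₀ x ≠ ∞) → ¬ FiniteDimensional ℝ Z →
    ∀ ε : ℝ, 0 < ε → ∃ x ∈ Z, M₀ x = 1 ∧ M₁ (T x) < ENNReal.ofReal ε

/-- `T` is finitely strictly singular w.r.t. the norms `M₀`, `M₁`. -/
def FinStrictlySingular {V₀ V₁ : Type*} [AddCommGroup V₀] [Module ℝ V₀]
    [AddCommGroup V₁] [Module ℝ V₁]
    (M₀ : V₀ → ℝ≥0∞) (M₁ : V₁ → ℝ≥0∞) (T : V₀ →ₗ[ℝ] V₁) : Prop :=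
  ∀ ε : ℝ, 0 < ε → ∃ N : ℕ, ∀ Z : Submodule ℝ V₀, (∀ x ∈ Z, M₀ x ≠ ∞) →
    (N : Cardinal) ≤ Module.rank ℝ Z → ∃ x ∈ Z, M₀ x = 1 ∧ M₁ (T x) ≤ ENNReal.ofReal ε

section ExtendedSequenceNorms

variable {ι : Type*}

lemma eSeqNorm_top (f : ι → ℝ≥0∞) : eSeqNorm ∞ f = ⨆ i, f i := if_pos rfl

lemma eSeqNorm_of_ne_top {q : ℝ≥0∞} (hq : q ≠ ∞) (f : ι → ℝ≥0∞) :
    eSeqNorm q f = (∑' i, f i ^ q.toReal) ^ (1 / q.toReal) := if_neg hq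

lemma eSeqNorm_rpow {q : ℝ≥0∞} (hq₀ : 0 < q) (hq : q ≠ ∞) (f : ι → ℝ≥0∞) :
    eSeqNorm q f ^ q.toReal = ∑' i, f i ^ q.toReal := by
  have h : q.toReal ≠ 0 := (ENNReal.toReal_pos hq₀.ne' hq).ne'
  rw [eSeqNorm_of_ne_top hq, ← ENNReal.rpow_mul, one_div_mul_cancel h, ENNReal.rpow_one]

lemma eSeqNorm_mono (q : ℝ≥0∞) {f g : ι → ℝ≥0∞} (h : ∀ i, f i ≤ g i) :
    eSeqNorm q f ≤ eSeqNorm q g := by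
  unfold eSeqNorm
  split_ifs
  · exact iSup_mono h
  · exact ENNReal.rpow_le_rpow
      (ENNReal.tsum_le_tsum fun i => ENNReal.rpow_le_rpow (h i) ENNReal.toReal_nonneg)
      (by positivity)

lemma eSeqNorm_const_mul {q : ℝ≥0∞} (hq : 0 < q) (c : ℝ≥0∞) (f : ι → ℝ≥0∞) :
    eSeqNorm q (fun i => c * f i) = c * eSeqNorm q f := by
  unfold eSeqNorm
  split_ifs with h
  · rw [ENNReal.mul_iSup]
  · have h' : q.toReal ≠ 0 := (ENNReal.toReal_pos hq.ne' h).ne'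
    simp_rw [ENNReal.mul_rpow_of_nonneg _ _ (ENNReal.toReal_nonneg (a := q))]
    rw [ENNReal.tsum_mul_left, ENNReal.mul_rpow_of_nonneg _ _ (by positivity),
      ← ENNReal.rpow_mul, mul_one_div_cancel h', ENNReal.rpow_one]

lemma le_eSeqNorm {q : ℝ≥0∞} (hq : 0 < q) (f : ι → ℝ≥0∞) (i : ι) : f i ≤ eSeqNorm q f := by
  by_cases h : q = ∞
  · subst h
    rw [eSeqNorm_top]
    exact le_iSup f i
  · rw [← ENNReal.rpow_le_rpow_iff (ENNReal.toReal_pos hq.ne' h), eSeqNorm_rpow hq h]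
    exact ENNReal.le_tsum i

lemma eSeqNorm_anti {p q : ℝ≥0∞} (hp : 0 < p) (hpq : p ≤ q) (f : ι → ℝ≥0∞) :
    eSeqNorm q f ≤ eSeqNorm p f := by
  by_cases hq : q = ∞
  · subst hq
    rw [eSeqNorm_top]
    exact iSup_le (le_eSeqNorm hp f)
  have hp' : p ≠ ∞ := ne_top_of_le_ne_top hq hpq
  have hq₀ : 0 < q := hp.trans_le hpq
  have hle : p.toReal ≤ q.toReal := ENNReal.toReal_mono hq hpq
  have hsplit : ∀ a : ℝ≥0∞, a ^ q.toReal = a ^ p.toReal * a ^ (q.toReal - p.toReal) := by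
    intro a
    rw [← ENNReal.rpow_add_of_nonneg _ _ ENNReal.toReal_nonneg (sub_nonneg.2 hle),
      add_sub_cancel]
  rw [← ENNReal.rpow_le_rpow_iff (ENNReal.toReal_pos hq₀.ne' hq), eSeqNorm_rpow hq₀ hq,
    hsplit (eSeqNorm p f), eSeqNorm_rpow hp hp', ← ENNReal.tsum_mul_right]
  refine ENNReal.tsum_le_tsum fun i => ?_
  rw [hsplit]
  exact mul_le_mul_right (ENNReal.rpow_le_rpow (le_eSeqNorm hp f i) (sub_nonneg.2 hle)) _

/-- Replacing the terms `g i` by terms `f i ≤ g i ^ (1 / l)` and multiplying the exponent by `l`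
turns the norm into its `l`-th root. -/
lemma eSeqNorm_le_rpow {l : ℝ} (hl : 0 < l) {q q' : ℝ≥0∞} (hq₀ : 0 < q) (hq : q ≠ ∞)
    (hq' : ENNReal.ofReal (l * q.toReal) ≤ q') {f g : ι → ℝ≥0∞}
    (h : ∀ i, f i ≤ g i ^ (1 / l)) : eSeqNorm q' f ≤ eSeqNorm q g ^ (1 / l) := by
  have hq_pos := ENNReal.toReal_pos hq₀.ne' hq
  have hlq : 0 < l * q.toReal := mul_pos hl hq_pos
  refine (eSeqNorm_anti (ENNReal.ofReal_pos.2 hlq) hq' f).trans ?_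
  rw [← ENNReal.rpow_le_rpow_iff hlq]
  have hroot := eSeqNorm_rpow (ENNReal.ofReal_pos.2 hlq) ENNReal.ofReal_ne_top f
  rw [ENNReal.toReal_ofReal hlq.le] at hroot
  have hexp : 1 / l * (l * q.toReal) = q.toReal := by field_simp
  rw [hroot, ← ENNReal.rpow_mul, hexp, eSeqNorm_rpow hq₀ hq]
  refine ENNReal.tsum_le_tsum fun i => ?_
  calc f i ^ (l * q.toReal) ≤ (g i ^ (1 / l)) ^ (l * q.toReal) := ENNReal.rpow_le_rpow (h i) hlq.le
    _ = g i ^ q.toReal := by rw [← ENNReal.rpow_mul, hexp]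

end ExtendedSequenceNorms

section MixedNorms

/-- The mixed norm of `ℓ^q(ℓ^p)`. -/
noncomputable def mixedNorm (q p : ℝ≥0∞) (a : ℕ → ℕ → ℝ≥0∞) : ℝ≥0∞ :=
  eSeqNorm q fun j => eSeqNorm p (a j)

lemma tsum_le_mixedNorm_rpow {p q r : ℝ≥0∞} (hp : 0 < p) (hq : 0 < q) (hr : r ≠ ∞)
    (hpr : p ≤ r) (hqr : q ≤ r) (a : ℕ → ℕ → ℝ≥0∞) :
    ∑' i : ℕ × ℕ, a i.1 i.2 ^ r.toReal ≤ mixedNorm q p a ^ r.toReal := by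
  have hr₀ : 0 < r := hp.trans_le hpr
  have h : mixedNorm r r a ≤ mixedNorm q p a :=
    (eSeqNorm_mono r fun j => eSeqNorm_anti hp hpr (a j)).trans (eSeqNorm_anti hq hqr _)
  refine le_trans (le_of_eq ?_) (ENNReal.rpow_le_rpow h ENNReal.toReal_nonneg)
  rw [mixedNorm, eSeqNorm_rpow hr₀ hr, ENNReal.tsum_prod (f := fun j k => a j k ^ r.toReal)]
  simp_rw [eSeqNorm_rpow hr₀ hr]

lemma mixedNorm_le_rpow {l : ℝ} (hl : 1 ≤ l) {p p' q q' : ℝ≥0∞} (hp₀ : 0 < p) (hp : p ≠ ∞)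
    (hq₀ : 0 < q) (hq : q ≠ ∞) (hp' : ENNReal.ofReal (l * p.toReal) ≤ p')
    (hq' : ENNReal.ofReal (l * q.toReal) ≤ q') {a : ℕ → ℕ → ℝ≥0∞}
    (ha : ∀ j k, a j k ≤ 1) : mixedNorm q' p' a ≤ mixedNorm q p a ^ (1 / l) := by
  have hl₀ : 0 < l := one_pos.trans_le hl
  refine eSeqNorm_le_rpow hl₀ hq₀ hq hq' fun j =>
    eSeqNorm_le_rpow hl₀ hp₀ hp hp' fun k => ?_
  have h := ENNReal.rpow_le_rpow_of_exponent_ge (ha j k) ((div_le_one hl₀).2 hl)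
  rwa [ENNReal.rpow_one] at h

lemma exists_one_lt_ofReal_mul_le {p p' : ℝ≥0∞} (hp : 0 < p) (h : p < p') :
    ∃ l : ℝ, 1 < l ∧ ENNReal.ofReal (l * p.toReal) ≤ p' := by
  obtain ⟨r, hpr, hr⟩ := exists_between h
  have hp_top : p ≠ ∞ := h.ne_top
  have hp_pos := ENNReal.toReal_pos hp.ne' hp_top
  refine ⟨r.toReal / p.toReal, ?_, ?_⟩
  · rw [one_lt_div hp_pos]
    exact (ENNReal.toReal_lt_toReal hp_top hr.ne_top).2 hpr
  · rw [div_mul_cancel₀ _ hp_pos.ne', ENNReal.ofReal_toReal hr.ne_top]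
    exact hr.le

/-- A quantitative comparison of mixed norms for arrays bounded by `1` which attain the value `1`
many times. -/
lemma exists_forall_mul_mixedNorm_le {p p' q q' : ℝ≥0∞} (hp₀ : 0 < p) (hp : p < p')
    (hq₀ : 0 < q) (hq : q < q') {K : ℝ≥0∞} (hK : K ≠ ∞) :
    ∃ n : ℕ, ∀ a : ℕ → ℕ → ℝ≥0∞, (∀ j k, a j k ≤ 1) →
      (∃ A : Finset (ℕ × ℕ), n ≤ A.card ∧ ∀ i ∈ A, a i.1 i.2 = 1) →
      1 ≤ mixedNorm q p a ∧ K * mixedNorm q' p' a ≤ mixedNorm q p a := by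
  obtain ⟨l₁, hl₁, hl₁'⟩ := exists_one_lt_ofReal_mul_le hp₀ hp
  obtain ⟨l₂, hl₂, hl₂'⟩ := exists_one_lt_ofReal_mul_le hq₀ hq
  set l := min l₁ l₂
  have hl : 1 < l := lt_min hl₁ hl₂
  have hlp : ENNReal.ofReal (l * p.toReal) ≤ p' :=
    (ENNReal.ofReal_le_ofReal
      (mul_le_mul_of_nonneg_right (min_le_left _ _) ENNReal.toReal_nonneg)).trans hl₁'
  have hlq : ENNReal.ofReal (l * q.toReal) ≤ q' :=
    (ENNReal.ofReal_le_ofReal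
      (mul_le_mul_of_nonneg_right (min_le_right _ _) ENNReal.toReal_nonneg)).trans hl₂'
  set r := max p q
  have hr : r ≠ ∞ := (max_lt hp.lt_top hq.lt_top).ne
  have hr₀ : 0 < r.toReal := ENNReal.toReal_pos (hp₀.trans_le (le_max_left _ _)).ne' hr
  have hl' : 0 < 1 - 1 / l := sub_pos.2 ((div_lt_one (one_pos.trans hl)).2 hl)
  set κ := (1 - 1 / l) / r.toReal with hκ_def
  have hκ : 0 < κ := div_pos hl' hr₀
  obtain ⟨n, hn⟩ := ENNReal.exists_nat_gt
    (ENNReal.rpow_ne_top_of_nonneg (inv_nonneg.2 hκ.le) hK)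
  have hn₀ : 0 < n := by
    rcases Nat.eq_zero_or_pos n with h | h
    · simp [h] at hn
    · exact h
  refine ⟨n, fun a ha ⟨A, hA, hA'⟩ => ?_⟩
  set S := mixedNorm q p a
  have hS : (n : ℝ≥0∞) ≤ S ^ r.toReal := by
    refine le_trans ?_ (tsum_le_mixedNorm_rpow hp₀ hq₀ hr (le_max_left _ _) (le_max_right _ _) a)
    refine le_trans ?_ (ENNReal.sum_le_tsum A)
    rw [Finset.sum_congr rfl fun i hi => by rw [hA' i hi, ENNReal.one_rpow]]
    simpa using hA
  have hS₁ : 1 ≤ S := by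
    rw [← ENNReal.rpow_le_rpow_iff hr₀, ENNReal.one_rpow]
    exact le_trans (by exact_mod_cast hn₀) hS
  refine ⟨hS₁, ?_⟩
  have hKS : K ≤ S ^ (1 - 1 / l) := by
    have h1 : K ≤ (n : ℝ≥0∞) ^ κ := (ENNReal.rpow_inv_le_iff hκ).1 hn.le
    refine h1.trans ((ENNReal.rpow_le_rpow hS hκ.le).trans (le_of_eq ?_))
    rw [← ENNReal.rpow_mul, hκ_def, mul_div_cancel₀ _ hr₀.ne']
  calc K * mixedNorm q' p' a ≤ S ^ (1 - 1 / l) * S ^ (1 / l) :=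
        mul_le_mul' hKS (mixedNorm_le_rpow hl.le hp₀ hp.ne_top hq₀ hq.ne_top hlp hlq ha)
    _ = S := by
        rw [← ENNReal.rpow_add_of_nonneg _ _ hl'.le (by positivity), sub_add_cancel,
          ENNReal.rpow_one]

end MixedNorms

section FlatVectors

variable {ι V : Type*} [AddCommGroup V] [Module ℝ V]

lemma exists_ne_zero_forall_mem_eq_zero (Φ : V →ₗ[ℝ] ι → ℝ) (A : Finset ι)
    (hA : (A.card : Cardinal) < Module.rank ℝ V) : ∃ y : V, y ≠ 0 ∧ ∀ k ∈ A, Φ y k = 0 := by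
  by_contra! h
  let Ψ : V →ₗ[ℝ] A → ℝ := LinearMap.pi fun k => (LinearMap.proj (k : ι)).comp Φ
  have hΨ : Function.Injective Ψ := by
    refine (injective_iff_map_eq_zero Ψ).2 fun y hy => ?_
    by_contra hy₀
    obtain ⟨k, hk, hne⟩ := h y hy₀
    exact hne (congrFun hy ⟨k, hk⟩)
  have := LinearMap.lift_rank_le_of_injective Ψ hΨ
  simp at this
  exact absurd hA (not_lt.2 this)

/-- If all values of `Φ` vanish at infinity and `x` attains absolute value `1` only on a finite set
too small to separate the points of `V`, then `x` may be moved so that it attains absolute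
value `1` at one more place. -/
lemma exists_flat_insert (Φ : V →ₗ[ℝ] ι → ℝ) (hΦ : Function.Injective Φ)
    (hc : ∀ x, ∀ ε > 0, {k | ε ≤ |Φ x k|}.Finite) (A : Finset ι)
    (hA : (A.card : Cardinal) < Module.rank ℝ V) {x : V} (hx : ∀ k, |Φ x k| ≤ 1)
    (hxA : ∀ k ∈ A, |Φ x k| = 1) :
    ∃ z : V, (∀ k, |Φ z k| ≤ 1) ∧ (∀ k ∈ A, |Φ z k| = 1) ∧ ∃ k ∉ A, |Φ z k| = 1 := by
  obtain ⟨y, hy₀, hyA⟩ := exists_ne_zero_forall_mem_eq_zero Φ A hA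
  obtain ⟨k₀, hk₀⟩ : ∃ k, Φ y k ≠ 0 := by
    by_contra! h
    exact hy₀ (hΦ (by rw [map_zero]; exact funext h))
  have hval : ∀ (τ : ℝ) k, Φ (x + τ • y) k = Φ x k + τ * Φ y k := by simp
  set T : Set ℝ := {τ | ∀ k, |Φ x k + τ * Φ y k| ≤ 1} with hT
  have hT₀ : (0 : ℝ) ∈ T := by simpa [hT] using hx
  have hT_closed : IsClosed T := by
    rw [hT, Set.ofPred_forall]
    exact isClosed_iInter fun k => isClosed_le (by fun_prop) continuous_const
  have hT_bdd : BddAbove T := by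
    refine ⟨2 / |Φ y k₀|, fun τ hτ => ?_⟩
    rw [le_div_iff₀ (abs_pos.2 hk₀)]
    have h1 := abs_le.1 (hτ k₀)
    have h2 := abs_le.1 (hx k₀)
    calc τ * |Φ y k₀| ≤ |τ * Φ y k₀| := by
          rw [abs_mul]; exact mul_le_mul_of_nonneg_right (le_abs_self τ) (abs_nonneg _)
      _ ≤ 2 := abs_le.2 ⟨by linarith, by linarith⟩
  have hmem : sSup T ∈ T := hT_closed.csSup_mem ⟨0, hT₀⟩ hT_bdd
  set σ := sSup T
  refine ⟨x + σ • y, fun k => by rw [hval]; exact hmem k,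
    fun k hk => by rw [hval, hyA k hk, mul_zero, add_zero, hxA k hk], ?_⟩
  by_contra! hlt
  simp_rw [hval] at hlt
  have hlt' : ∀ k ∉ A, |Φ x k + σ * Φ y k| < 1 := fun k hk => lt_of_le_of_ne (hmem k) (hlt k hk)
  -- Only finitely many constraints can become violated when `σ` is increased by at most `1`.
  have hfin : ({k | (1 / 2 : ℝ) ≤ |Φ (x + σ • y) k|} ∪ {k | (1 / 2 : ℝ) ≤ |Φ y k|}).Finite :=
    (hc _ _ (by norm_num)).union (hc _ _ (by norm_num))
  have hnear : ∀ᶠ τ in nhds σ, ∀ k ∈ hfin.toFinset, k ∉ A → |Φ x k + τ * Φ y k| < 1 := by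
    rw [Filter.eventually_all_finset]
    intro k _
    by_cases hk : k ∈ A
    · simp [hk]
    · have hcont : Continuous fun τ : ℝ => |Φ x k + τ * Φ y k| := by fun_prop
      filter_upwards [hcont.continuousAt.eventually_lt continuousAt_const (hlt' k hk)] with τ hτ _
      exact hτ
  obtain ⟨δ, hδ, hball⟩ := Metric.eventually_nhds_iff.1 hnear
  set η := min (δ / 2) 1
  have hη₀ : 0 < η := lt_min (by linarith) one_pos
  have hη₁ : η ≤ 1 := min_le_right _ _
  have hησ : dist (σ + η) σ < δ := by
    rw [Real.dist_eq, add_sub_cancel_left, abs_of_pos hη₀]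
    exact (min_le_left _ _).trans_lt (by linarith)
  have : σ + η ∈ T := by
    intro k
    by_cases hkA : k ∈ A
    · rw [hyA k hkA, mul_zero, add_zero]
      exact hx k
    by_cases hk : k ∈ hfin.toFinset
    · exact (hball hησ k hk hkA).le
    · rw [Set.Finite.mem_toFinset, Set.mem_union, not_or, Set.mem_ofPred_eq, Set.mem_ofPred_eq,
        not_le, not_le, hval] at hk
      calc |Φ x k + (σ + η) * Φ y k| = |(Φ x k + σ * Φ y k) + η * Φ y k| := by ring_nf
        _ ≤ |Φ x k + σ * Φ y k| + |η * Φ y k| := abs_add_le _ _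
        _ ≤ 1 / 2 + 1 * (1 / 2) := by
            rw [abs_mul, abs_of_pos hη₀]
            exact add_le_add hk.1.le (mul_le_mul hη₁ hk.2.le (abs_nonneg _) zero_le_one)
        _ = 1 := by norm_num
  have := le_csSup hT_bdd this
  linarith

/-- Milman's lemma: an `n`-dimensional space of functions vanishing at infinity contains a function
bounded by `1` in absolute value which attains the absolute value `1` at least `n` times. -/
lemma exists_flat (Φ : V →ₗ[ℝ] ι → ℝ) (hΦ : Function.Injective Φ)
    (hc : ∀ x, ∀ ε > 0, {k | ε ≤ |Φ x k|}.Finite) (n : ℕ) (hn : (n : Cardinal) ≤ Module.rank ℝ V) :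
    ∃ x : V, (∀ k, |Φ x k| ≤ 1) ∧ ∃ A : Finset ι, A.card = n ∧ ∀ k ∈ A, |Φ x k| = 1 := by
  classical
  induction n with
  | zero => exact ⟨0, by simp, ∅, by simp⟩
  | succ n ih =>
    have hlt : (n : Cardinal) < Module.rank ℝ V :=
      lt_of_lt_of_le (by exact_mod_cast n.lt_succ_self) hn
    obtain ⟨x, hx, A, hA, hxA⟩ := ih hlt.le
    obtain ⟨z, hz, hzA, k, hk, hzk⟩ := exists_flat_insert Φ hΦ hc A (by rwa [hA]) hx hxA
    refine ⟨z, hz, insert k A, by rw [Finset.card_insert_of_notMem hk, hA], fun i hi => ?_⟩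
    rcases Finset.mem_insert.1 hi with rfl | hi
    · exact hzk
    · exact hzA i hi

end FlatVectors

section WeightedNorms

/-- Multiplication of the `j`-th row of a double sequence by `2^{jt}`, as a function on `ℕ × ℕ`. -/
noncomputable def weightMap (t : ℝ) : (ℕ → ℕ → ℝ) →ₗ[ℝ] ℕ × ℕ → ℝ where
  toFun x i := (2 : ℝ) ^ ((i.1 : ℝ) * t) * x i.1 i.2
  map_add' x y := by ext i; simp [mul_add]
  map_smul' c x := by ext i; simp [mul_left_comm]

lemma weightMap_injective (t : ℝ) : Function.Injective (weightMap t) := by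
  intro x y h
  ext j k
  have := congrFun h (j, k)
  exact mul_left_cancel₀ (Real.rpow_pos_of_pos two_pos _).ne' this

lemma ofReal_abs_weightMap (t : ℝ) (x : ℕ → ℕ → ℝ) (j k : ℕ) :
    ENNReal.ofReal |weightMap t x (j, k)| = 2 ^ ((j : ℝ) * t) * ENNReal.ofReal |x j k| := by
  have h : (0 : ℝ) < 2 ^ ((j : ℝ) * t) := Real.rpow_pos_of_pos two_pos _
  change ENNReal.ofReal |(2 : ℝ) ^ ((j : ℝ) * t) * x j k| = _
  rw [abs_mul, abs_of_pos h, ENNReal.ofReal_mul h.le, ← ENNReal.ofReal_rpow_of_pos two_pos]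
  simp

lemma wNorm_eq_mixedNorm {p : ℝ≥0∞} (hp : 0 < p) (q : ℝ≥0∞) (t : ℝ) (x : ℕ → ℕ → ℝ) :
    wNorm q t p x = mixedNorm q p fun j k => ENNReal.ofReal |weightMap t x (j, k)| := by
  simp_rw [ofReal_abs_weightMap]
  simp only [wNorm, mixedNorm, elpNorm, eSeqNorm_const_mul hp]

lemma wNorm_smul {p q : ℝ≥0∞} (hp : 0 < p) (hq : 0 < q) (s c : ℝ) (x : ℕ → ℕ → ℝ) :
    wNorm q s p (c • x) = ENNReal.ofReal |c| * wNorm q s p x := by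
  simp only [wNorm, elpNorm, Pi.smul_apply, smul_eq_mul, abs_mul,
    ENNReal.ofReal_mul (abs_nonneg c), eSeqNorm_const_mul hp, mul_left_comm _ (ENNReal.ofReal |c|),
    eSeqNorm_const_mul hq]

lemma wNorm_le_of_le {s t : ℝ} (hst : t ≤ s) (p q : ℝ≥0∞) (x : ℕ → ℕ → ℝ) :
    wNorm q t p x ≤ wNorm q s p x := by
  refine eSeqNorm_mono q fun j => ?_
  gcongr
  norm_num

/-- A gain in the weight allows an arbitrary change of the outer exponent. -/
lemma exists_wNorm_le_mul {s t : ℝ} (hst : t < s) {q q' : ℝ≥0∞} (hq : 0 < q) (hq'₀ : 0 < q')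
    (hq' : q' ≠ ∞) (p : ℝ≥0∞) :
    ∃ C : ℝ≥0∞, C ≠ ∞ ∧ ∀ x, wNorm q' t p x ≤ C * wNorm q s p x := by
  refine ⟨eSeqNorm q' fun j : ℕ => (2 : ℝ≥0∞) ^ ((j : ℝ) * (t - s)), ?_, fun x => ?_⟩
  · rw [eSeqNorm_of_ne_top hq']
    refine ENNReal.rpow_ne_top_of_nonneg (by positivity) ?_
    have hpow : ∀ j : ℕ, ((2 : ℝ≥0∞) ^ ((j : ℝ) * (t - s))) ^ q'.toReal =
        ((2 : ℝ≥0∞) ^ ((t - s) * q'.toReal)) ^ j := by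
      intro j
      rw [← ENNReal.rpow_mul, ← ENNReal.rpow_natCast, ← ENNReal.rpow_mul]
      ring_nf
    simp_rw [hpow]
    rw [ENNReal.tsum_geometric, ENNReal.inv_ne_top, ne_eq, tsub_eq_zero_iff_le, not_le]
    refine ENNReal.rpow_lt_one_of_one_lt_of_neg (by norm_num) ?_
    exact mul_neg_of_neg_of_pos (sub_neg.2 hst) (ENNReal.toReal_pos hq'₀.ne' hq')
  · rw [mul_comm, ← eSeqNorm_const_mul hq'₀]
    refine eSeqNorm_mono q' fun j => ?_
    calc (2 : ℝ≥0∞) ^ ((j : ℝ) * t) * elpNorm p (x j)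
        = (2 ^ ((j : ℝ) * s) * elpNorm p (x j)) * 2 ^ ((j : ℝ) * (t - s)) := by
          rw [mul_right_comm, ← ENNReal.rpow_add _ _ (by norm_num) (by norm_num)]
          ring_nf
      _ ≤ wNorm q s p x * 2 ^ ((j : ℝ) * (t - s)) := by
          gcongr
          exact le_eSeqNorm hq (fun j : ℕ => (2 : ℝ≥0∞) ^ ((j : ℝ) * s) * elpNorm p (x j)) j

/-- If both exponents increase strictly, then every subspace of sufficiently large dimension
contains a nonzero vector whose second norm is smaller than the first one by a given factor. -/
lemma exists_mul_wNorm_le (t : ℝ) {p p' q q' : ℝ≥0∞} (hp₀ : 0 < p) (hp : p < p') (hq₀ : 0 < q)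
    (hq : q < q') {K : ℝ≥0∞} (hK : K ≠ ∞) :
    ∃ n : ℕ, ∀ Z : Submodule ℝ (ℕ → ℕ → ℝ), (∀ x ∈ Z, wNorm q t p x ≠ ∞) →
      (n : Cardinal) ≤ Module.rank ℝ Z →
      ∃ x ∈ Z, wNorm q t p x ≠ 0 ∧ K * wNorm q' t p' x ≤ wNorm q t p x := by
  obtain ⟨n, hn⟩ := exists_forall_mul_mixedNorm_le hp₀ hp hq₀ hq hK
  refine ⟨n, fun Z hZ hrank => ?_⟩
  have hr : max p q ≠ ∞ := (max_lt hp.lt_top hq.lt_top).ne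
  have hr₀ : 0 < (max p q).toReal := ENNReal.toReal_pos (hp₀.trans_le (le_max_left _ _)).ne' hr
  have hc : ∀ x : Z, ∀ ε > 0, {i | ε ≤ |(weightMap t ∘ₗ Z.subtype) x i|}.Finite := by
    intro x ε hε
    have hsum := ne_top_of_le_ne_top
      (ENNReal.rpow_ne_top_of_nonneg hr₀.le (by simpa only [wNorm_eq_mixedNorm hp₀] using hZ x x.2))
      (tsum_le_mixedNorm_rpow hp₀ hq₀ hr (le_max_left _ _) (le_max_right _ _)
        fun j k => ENNReal.ofReal |weightMap t x (j, k)|)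
    refine (ENNReal.finite_const_le_of_tsum_ne_top hsum
      (ENNReal.rpow_pos (p := (max p q).toReal) (ENNReal.ofReal_pos.2 hε) ENNReal.ofReal_ne_top).ne').subset fun i hi => ?_
    exact ENNReal.rpow_le_rpow (ENNReal.ofReal_le_ofReal hi) hr₀.le
  obtain ⟨x, hx, A, hA, hxA⟩ := exists_flat (weightMap t ∘ₗ Z.subtype)
    ((weightMap_injective t).comp Z.subtype_injective) hc n hrank
  obtain ⟨h₁, h₂⟩ := hn (fun j k => ENNReal.ofReal |weightMap t x (j, k)|)
    (fun j k => ENNReal.ofReal_le_one.2 (hx (j, k)))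
    ⟨A, hA.ge, fun i hi => by simpa using congrArg ENNReal.ofReal (hxA i hi)⟩
  refine ⟨x, x.2, ?_, ?_⟩
  · rw [wNorm_eq_mixedNorm hp₀]
    exact (one_pos.trans_le h₁).ne'
  · rwa [wNorm_eq_mixedNorm hp₀, wNorm_eq_mixedNorm (hp₀.trans hp)]

end WeightedNorms

lemma FinStrictlySingular.strictlySingular {V₀ V₁ : Type*} [AddCommGroup V₀] [Module ℝ V₀]
    [AddCommGroup V₁] [Module ℝ V₁] {M₀ : V₀ → ℝ≥0∞} {M₁ : V₁ → ℝ≥0∞} {T : V₀ →ₗ[ℝ] V₁}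
    (h : FinStrictlySingular M₀ M₁ T) : StrictlySingular M₀ M₁ T := by
  intro Z hZ hdim ε hε
  obtain ⟨N, hN⟩ := h (ε / 2) (half_pos hε)
  have hrank : Cardinal.aleph0 ≤ Module.rank ℝ Z :=
    not_lt.1 fun hlt => hdim (Module.rank_lt_aleph0_iff.1 hlt)
  obtain ⟨x, hx, hx₀, hx₁⟩ := hN Z hZ ((Cardinal.natCast_lt_aleph0).le.trans hrank)
  exact ⟨x, hx, hx₀, hx₁.trans_lt ((ENNReal.ofReal_lt_ofReal_iff hε).2 (half_lt_self hε))⟩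

lemma finStrictlySingular_id {s t : ℝ} (hst : t ≤ s) {p₀ p₁ q₀ q₁ : ℝ≥0∞}
    (hp₀ : 0 < p₀) (hp : p₀ < p₁) (hq₀ : 0 < q₀) (hq₁ : 0 < q₁) (hcase : t < s ∨ q₀ < q₁) :
    FinStrictlySingular (wNorm q₀ s p₀) (wNorm q₁ t p₁)
      (LinearMap.id : (ℕ → ℕ → ℝ) →ₗ[ℝ] (ℕ → ℕ → ℝ)) := by
  obtain ⟨q, C, hq, hqq₁, hC, hle⟩ : ∃ q C : ℝ≥0∞, 0 < q ∧ q < q₁ ∧ C ≠ ∞ ∧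
      ∀ x, wNorm q t p₀ x ≤ C * wNorm q₀ s p₀ x := by
    rcases hcase with h | h
    · obtain ⟨q, hq, hqq₁⟩ := exists_between hq₁
      obtain ⟨C, hC, hle⟩ := exists_wNorm_le_mul h hq₀ hq hqq₁.ne_top p₀
      exact ⟨q, C, hq, hqq₁, hC, hle⟩
    · exact ⟨q₀, 1, hq₀, h, ENNReal.one_ne_top, fun x => by
        rw [one_mul]; exact wNorm_le_of_le hst p₀ q₀ x⟩
  intro ε hε
  have hε₀ : ENNReal.ofReal ε ≠ 0 := (ENNReal.ofReal_pos.2 hε).ne'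
  have hK : (C + 1) / ENNReal.ofReal ε ≠ ∞ :=
    ENNReal.div_ne_top (ENNReal.add_ne_top.2 ⟨hC, ENNReal.one_ne_top⟩) hε₀
  obtain ⟨n, hn⟩ := exists_mul_wNorm_le t hp₀ hp hq hqq₁ hK
  refine ⟨n, fun Z hZ hrank => ?_⟩
  obtain ⟨x, hxZ, hx₀, hx⟩ := hn Z
    (fun x hx => ne_top_of_le_ne_top (ENNReal.mul_ne_top hC (hZ x hx)) (hle x)) hrank
  set M := wNorm q₀ s p₀ x with hM
  have hM_top : M ≠ ∞ := hZ x hxZ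
  have hM₀ : M ≠ 0 := fun h => hx₀ (le_antisymm ((hle x).trans (by rw [← hM, h, mul_zero])) bot_le)
  have hbound : wNorm q₁ t p₁ x ≤ ENNReal.ofReal ε * M := by
    have h1 : (C + 1) / ENNReal.ofReal ε * wNorm q₁ t p₁ x ≤ (C + 1) * M :=
      hx.trans ((hle x).trans (mul_le_mul_left le_self_add _))
    rw [div_eq_mul_inv, mul_assoc, ENNReal.mul_le_mul_iff_right (by simp)
      (ENNReal.add_ne_top.2 ⟨hC, ENNReal.one_ne_top⟩)] at h1
    rwa [mul_comm, ← div_eq_mul_inv, ENNReal.div_le_iff hε₀ ENNReal.ofReal_ne_top, mul_comm] at h1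
  have hinv : ENNReal.ofReal |M.toReal⁻¹| = M⁻¹ := by
    rw [abs_of_nonneg (by positivity), ENNReal.ofReal_inv_of_pos (ENNReal.toReal_pos hM₀ hM_top),
      ENNReal.ofReal_toReal hM_top]
  refine ⟨M.toReal⁻¹ • x, Z.smul_mem _ hxZ, ?_, ?_⟩
  · rw [wNorm_smul hp₀ hq₀, hinv, ← hM, ENNReal.inv_mul_cancel hM₀ hM_top]
  · rw [LinearMap.id_apply, wNorm_smul (hp₀.trans hp) hq₁, hinv, mul_comm,
      ← div_eq_mul_inv, ENNReal.div_le_iff hM₀ hM_top]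
    exact hbound

theorem statement6 (s t : ℝ) (hst : t ≤ s) (p₀ p₁ q₀ q₁ : ℝ≥0∞)
    (hp₀ : 0 < p₀) (hp : p₀ < p₁) (hq₀ : 0 < q₀) (hq₁ : 0 < q₁)
    (hcase : t < s ∨ q₀ < q₁) :
    FinStrictlySingular (wNorm q₀ s p₀) (wNorm q₁ t p₁)
      (LinearMap.id : (ℕ → ℕ → ℝ) →ₗ[ℝ] (ℕ → ℕ → ℝ))
    ∧ StrictlySingular (wNorm q₀ s p₀) (wNorm q₁ t p₁)
      (LinearMap.id : (ℕ → ℕ → ℝ) →ₗ[ℝ] (ℕ → ℕ → ℝ)) := by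
  have h := finStrictlySingular_id hst hp₀ hp hq₀ hq₁ hcase
  exact ⟨h, h.strictlySingular⟩

end Stmt6
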